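/- arXiv:math/0310340 — 9 statements merged into one kernel-verified Lean document; each statement's English description precedes it below -/
import Mathlib

section
/- Let M and N be additive commutative monoids and let α : M → N be a surjective monoid homomorphism such that for all x, y ∈ M, if α(x) ∝ α(y) in N then x ∝ y in M. Then for every order-ideal J of N the preimage α⁻¹(J) is an order-ideal of M, and the map J ↦ α⁻¹(J) is a bijection from the set of order-ideals of N onto the set of order-ideals of M which preserves inclusion in both directions (i.e., it is an order isomorphism of the ideal lattices). -/
/-- The algebraic preorder on an additive commutative monoid: `x ≤ y` iff
`x + z = y` for some `z`. -/
def AlgLE {M : Type*} [AddCommMonoid M] (x y : M) : Prop := ∃ z : M, x + z = y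

/-- `x ∝ y` : `x ≤ n • y` for some natural number `n ≥ 1`. -/
def Propto {M : Type*} [AddCommMonoid M] (x y : M) : Prop :=
  ∃ n : ℕ, 1 ≤ n ∧ AlgLE x (n • y)

/-- An order-ideal of an additive commutative monoid: a submonoid `I`
such that `x + y ∈ I ↔ x ∈ I ∧ y ∈ I`. -/
def IsOrderIdeal {M : Type*} [AddCommMonoid M] (I : Set M) : Prop :=
  (0 : M) ∈ I ∧ ∀ x y : M, x + y ∈ I ↔ x ∈ I ∧ y ∈ I

theorem IsOrderIdeal.nsmul_mem {M : Type*} [AddCommMonoid M] {I : Set M}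
    (hI : IsOrderIdeal I) {x : M} (hx : x ∈ I) (n : ℕ) : n • x ∈ I := by
  induction n with
  | zero => simpa using hI.1
  | succ n ih => simpa only [succ_nsmul] using (hI.2 _ _).2 ⟨ih, hx⟩

theorem IsOrderIdeal.mem_of_propto {M : Type*} [AddCommMonoid M] {I : Set M}
    (hI : IsOrderIdeal I) {x y : M} (h : Propto x y) (hy : y ∈ I) : x ∈ I := by
  obtain ⟨n, -, z, hz⟩ := h
  exact ((hI.2 x z).1 (hz ▸ hI.nsmul_mem hy n)).1

theorem Propto.refl {M : Type*} [AddCommMonoid M] (x : M) : Propto x x :=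
  ⟨1, le_rfl, 0, by simp⟩

theorem IsOrderIdeal.preimage {M N : Type*} [AddCommMonoid M] [AddCommMonoid N]
    (α : M →+ N) {J : Set N} (hJ : IsOrderIdeal J) : IsOrderIdeal (α ⁻¹' J) :=
  ⟨by simpa using hJ.1, fun x y => by simpa using hJ.2 (α x) (α y)⟩

theorem IsOrderIdeal.map_mem_image_iff {M N : Type*} [AddCommMonoid M] [AddCommMonoid N]
    {α : M →+ N} (hprop : ∀ x y : M, Propto (α x) (α y) → Propto x y)
    {I : Set M} (hI : IsOrderIdeal I) {x : M} : α x ∈ α '' I ↔ x ∈ I := by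
  refine ⟨?_, Set.mem_image_of_mem α⟩
  rintro ⟨y, hy, hyx⟩
  exact hI.mem_of_propto (hprop x y (hyx ▸ Propto.refl _)) hy

theorem IsOrderIdeal.image {M N : Type*} [AddCommMonoid M] [AddCommMonoid N]
    {α : M →+ N} (hsurj : Function.Surjective α)
    (hprop : ∀ x y : M, Propto (α x) (α y) → Propto x y)
    {I : Set M} (hI : IsOrderIdeal I) : IsOrderIdeal (α '' I) := by
  refine ⟨⟨0, hI.1, map_zero α⟩, fun a b => ?_⟩
  obtain ⟨x, rfl⟩ := hsurj a
  obtain ⟨y, rfl⟩ := hsurj b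
  rw [← map_add, hI.map_mem_image_iff hprop, hI.map_mem_image_iff hprop,
    hI.map_mem_image_iff hprop]
  exact hI.2 x y

theorem stmt_0 {M N : Type*} [AddCommMonoid M] [AddCommMonoid N]
    (α : M →+ N) (hsurj : Function.Surjective α)
    (hprop : ∀ x y : M, Propto (α x) (α y) → Propto x y) :
    (∀ J : Set N, IsOrderIdeal J → IsOrderIdeal (α ⁻¹' J)) ∧
    ∃ F : {J : Set N // IsOrderIdeal J} ≃ {I : Set M // IsOrderIdeal I},
      (∀ J : {J : Set N // IsOrderIdeal J}, (F J : Set M) = α ⁻¹' (J : Set N)) ∧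
      (∀ J₁ J₂ : {J : Set N // IsOrderIdeal J},
        (J₁ : Set N) ⊆ (J₂ : Set N) ↔ (F J₁ : Set M) ⊆ (F J₂ : Set M)) := by
  refine ⟨fun J hJ => hJ.preimage α,
    { toFun := fun J => ⟨α ⁻¹' J, J.2.preimage α⟩
      invFun := fun I => ⟨α '' I, I.2.image hsurj hprop⟩
      left_inv := fun J => Subtype.ext (Set.image_preimage_eq _ hsurj)
      right_inv := fun I => Subtype.ext (Set.ext fun _ => I.2.map_mem_image_iff hprop) },
    fun _ => rfl, fun _ _ => hsurj.preimage_subset_preimage_iff.symm⟩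
end

section
/- Let Δ = (ℤ₊)^r be the simplicial monoid of rank r, let M be a refinement monoid, let α : Δ → M be a monoid homomorphism, let I and J be nonempty disjoint subsets of {1, …, r} with α(e_J) ∝ α(e_I) in M, and let j ∈ J. Then there exist a natural number s ≥ 2|I| + |J| − 1, monoid homomorphisms β : (ℤ₊)^r → (ℤ₊)^s and α' : (ℤ₊)^s → M, a subset K of {1, …, s}, and an injective map θ : J ∖ {j} → {1, …, s} whose image is disjoint from K, such that: α' ∘ β = α (hence the range of α is contained in the range of α'); β(e_k) = e_{θ(k)} in (ℤ₊)^s for every k ∈ J ∖ {j}; β(e_j) ∝ β(e_I) and β(e_I) = e_K in (ℤ₊)^s; and α'(e_{θ(J∖{j})}) ∝ α'(e_K) in M. -/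
/-- A refinement monoid. -/
def IsRefinement (M : Type*) [AddCommMonoid M] : Prop :=
  ∀ x₁ x₂ y₁ y₂ : M, x₁ + x₂ = y₁ + y₂ →
    ∃ z₁₁ z₁₂ z₂₁ z₂₂ : M,
      x₁ = z₁₁ + z₁₂ ∧ x₂ = z₂₁ + z₂₂ ∧ y₁ = z₁₁ + z₂₁ ∧ y₂ = z₁₂ + z₂₂

/-- `e_I`, the indicator vector of a subset `I` of indices, i.e. the sum of
the canonical basis vectors `e_i` for `i ∈ I`. -/
def ind {n : ℕ} (I : Finset (Fin n)) : Fin n → ℕ := fun j => if j ∈ I then 1 else 0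

open Finset

/-- The additive homomorphism out of a simplicial monoid with prescribed values on the basis. -/
def basisLift {κ N : Type*} [Fintype κ] [AddCommMonoid N] (v : κ → N) : (κ → ℕ) →+ N where
  toFun f := ∑ k, f k • v k
  map_zero' := by simp
  map_add' f g := by simp [add_smul, sum_add_distrib]

theorem basisLift_ind_singleton {n : ℕ} {N : Type*} [AddCommMonoid N] (v : Fin n → N)
    (k : Fin n) : basisLift v (ind {k}) = v k := by
  simp [basisLift, ind]

theorem ind_eq_sum {n : ℕ} (A : Finset (Fin n)) : ind A = ∑ k ∈ A, ind {k} := by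
  ext l
  simp [ind, Finset.sum_apply]

theorem addMonoidHom_ext_ind {n : ℕ} {N : Type*} [AddCommMonoid N] {f g : (Fin n → ℕ) →+ N}
    (h : ∀ k, f (ind {k}) = g (ind {k})) : f = g := by
  refine AddMonoidHom.functions_ext N f g fun k x => ?_
  have hx : (Pi.single k x : Fin n → ℕ) = x • ind {k} := by
    ext l
    by_cases hl : l = k <;> simp [ind, hl]
  rw [hx, map_nsmul, map_nsmul, h]

/-- In a refinement monoid, a decomposition `y + z` of a nonempty finite sum splits every
summand compatibly. -/
theorem IsRefinement.exists_split_sum {M ι : Type*} [AddCommMonoid M] (hM : IsRefinement M)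
    {A : Finset ι} (hA : A.Nonempty) (x : ι → M) :
    ∀ {y z : M}, y + z = ∑ i ∈ A, x i →
      ∃ a b : ι → M, (∀ i ∈ A, x i = a i + b i) ∧ y = ∑ i ∈ A, a i ∧ z = ∑ i ∈ A, b i := by
  classical
  induction hA using Finset.Nonempty.cons_induction with
  | singleton i =>
    intro y z h
    exact ⟨fun _ => y, fun _ => z, by simpa using h.symm, by simp, by simp⟩
  | cons i A hi _ ih =>
    intro y z h
    rw [sum_cons] at h
    obtain ⟨p, q, p', q', rfl, rfl, hx, hs⟩ := hM _ _ _ _ h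
    obtain ⟨a, b, hab, rfl, rfl⟩ := ih hs.symm
    have hne : ∀ l ∈ A, l ≠ i := fun l hl e => hi (e ▸ hl)
    refine ⟨Function.update a i p, Function.update b i p', ?_, ?_, ?_⟩
    · intro l hl
      rcases mem_cons.1 hl with rfl | hl
      · simpa using hx
      · simpa [hne l hl] using hab l hl
    · rw [sum_cons, Function.update_self]
      congr 1
      exact sum_congr rfl fun l hl => by simp [hne l hl]
    · rw [sum_cons, Function.update_self]
      congr 1
      exact sum_congr rfl fun l hl => by simp [hne l hl]

/-- In a refinement monoid, if `y ≤ n • ∑ i, x i` then the `x i` can be decomposed into pieces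
such that `y` is a nonnegative integer combination of these pieces. -/
theorem IsRefinement.exists_pieces {M : Type*} [AddCommMonoid M] (hM : IsRefinement M)
    {n : ℕ} (hn : 1 ≤ n) :
    ∀ (ι : Type) [Fintype ι] [Nonempty ι] (x : ι → M) (y z : M), y + z = n • ∑ i, x i →
      ∃ (T : Type) (_ : Fintype T) (w : ι → T → M) (c : ι → T → ℕ),
        2 ≤ Fintype.card T ∧ (∀ i, x i = ∑ t, w i t) ∧ y = ∑ i, ∑ t, c i t • w i t := by
  induction n, hn using Nat.le_induction with
  | base =>
    intro ι _ _ x y z h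
    rw [one_smul] at h
    obtain ⟨a, b, hab, rfl, rfl⟩ := hM.exists_split_sum univ_nonempty x h
    refine ⟨Bool, inferInstance, fun i t => if t then a i else b i,
      fun _ t => if t then 1 else 0, by simp, fun i => ?_, ?_⟩
    · simpa using hab i (mem_univ i)
    · simp
  | succ n _ ih =>
    intro ι _ _ x y z h
    rw [succ_nsmul] at h
    obtain ⟨y₂, y₁, z₂, z₁, rfl, rfl, h₂, h₁⟩ := hM _ _ _ _ h
    obtain ⟨a, b, hab, rfl, rfl⟩ := hM.exists_split_sum univ_nonempty x h₁.symm
    have hsum : ∑ i, x i = ∑ p : ι × Bool, if p.2 then a p.1 else b p.1 := by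
      rw [Fintype.sum_prod_type]
      exact sum_congr rfl fun i hi => by simpa using hab i hi
    rw [hsum] at h₂
    obtain ⟨T, _, w, c, hT, hw, rfl⟩ := ih (ι × Bool) _ y₂ z₂ h₂.symm
    have ha : ∀ i, a i = ∑ t, w (i, true) t := fun i => by simpa using hw (i, true)
    have hb : ∀ i, b i = ∑ t, w (i, false) t := fun i => by simpa using hw (i, false)
    refine ⟨Bool × T, inferInstance, fun i p => w (i, p.1) p.2,
      fun i p => c (i, p.1) p.2 + if p.1 then 1 else 0, ?_, fun i => ?_, ?_⟩
    · rw [Fintype.card_prod, Fintype.card_bool]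
      omega
    · rw [hab i (mem_univ i), ha, hb, Fintype.sum_prod_type]
      simp
    · simp only [Fintype.sum_prod_type, Fintype.sum_bool, ha, add_smul, sum_add_distrib]
      simp

theorem propto_sum_smul {N ι : Type*} [AddCommMonoid N] (A : Finset ι) (g : ι → N) (c : ι → ℕ) :
    Propto (∑ i ∈ A, c i • g i) (∑ i ∈ A, g i) := by
  refine ⟨1 + ∑ i ∈ A, c i, by omega, ∑ i ∈ A, (1 + ∑ l ∈ A, c l - c i) • g i, ?_⟩
  rw [← sum_add_distrib, smul_sum]
  refine sum_congr rfl fun i hi => ?_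
  have := single_le_sum (f := c) (fun _ _ => Nat.zero_le _) hi
  rw [← add_smul]
  congr 1
  omega

theorem AlgLE.add_left {M : Type*} [AddCommMonoid M] {a b c : M} (h : AlgLE (a + b) c) :
    AlgLE b c := by
  obtain ⟨z, rfl⟩ := h
  exact ⟨a + z, by abel⟩

theorem stmt_3 {M : Type*} [AddCommMonoid M] (r : ℕ)
    (hM : IsRefinement M) (α : (Fin r → ℕ) →+ M)
    (I J : Finset (Fin r)) (hI : I.Nonempty) (hJ : J.Nonempty)
    (hdisj : Disjoint I J)
    (h : Propto (α (ind J)) (α (ind I)))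
    (j : Fin r) (hj : j ∈ J) :
    ∃ (s : ℕ) (β : (Fin r → ℕ) →+ (Fin s → ℕ)) (α' : (Fin s → ℕ) →+ M)
      (K : Finset (Fin s)) (θ : Fin r → Fin s),
      2 * I.card + J.card - 1 ≤ s ∧
      α'.comp β = α ∧
      Set.InjOn θ (J.erase j : Finset (Fin r)) ∧
      (∀ k ∈ J.erase j, θ k ∉ K) ∧
      (∀ k ∈ J.erase j, β (ind {k}) = ind {θ k}) ∧
      Propto (β (ind {j})) (β (ind I)) ∧
      β (ind I) = ind K ∧
      Propto (α' (ind ((J.erase j).image θ))) (α' (ind K)) := by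
  obtain ⟨n, hn, hle⟩ := h
  have hJ' : α (ind J) = α (ind {j}) + α (ind (J.erase j)) := by
    rw [← map_add, ind_eq_sum J, ind_eq_sum (J.erase j), add_sum_erase J (fun k => ind {k}) hj]
  have hjI : j ∉ I := fun hjI => disjoint_left.1 hdisj hjI hj
  rw [hJ'] at hle
  obtain ⟨z, hz⟩ := (add_comm (α (ind {j})) _ ▸ hle).add_left
  have hαI : α (ind I) = ∑ i : I, α (ind {i.1}) := by
    rw [ind_eq_sum I, map_sum, sum_coe_sort I fun i => α (ind {i})]
  rw [hαI] at hz
  have : Nonempty I := hI.to_subtype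
  obtain ⟨T, _, w, c, hT, hw, hy⟩ := hM.exists_pieces hn I _ _ z hz
  let R := {k : Fin r // k ∉ I ∧ k ≠ j}
  let e := Fintype.equivFin ((I × T) ⊕ R)
  have : Nonempty T := Fintype.card_pos_iff.1 (by omega)
  let p₀ : I × T := Classical.arbitrary _
  let θ : Fin r → Fin (Fintype.card ((I × T) ⊕ R)) := fun k =>
    if hk : k ∉ I ∧ k ≠ j then e (.inr ⟨k, hk⟩) else e (.inl p₀)
  let g : I × T → Fin (Fintype.card ((I × T) ⊕ R)) → ℕ := fun p => ind {e (.inl p)}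
  let v : Fin r → Fin (Fintype.card ((I × T) ⊕ R)) → ℕ := fun k =>
    if hk : k ∈ I then ∑ t, g (⟨k, hk⟩, t)
    else if k = j then ∑ p : I × T, c p.1 p.2 • g p else ind {θ k}
  let α' := basisLift fun q => Sum.elim (fun p : I × T => w p.1 p.2)
    (fun k : R => α (ind {k.1})) (e.symm q)
  have hα'g (p : I × T) : α' (g p) = w p.1 p.2 := by
    simp [α', g, basisLift_ind_singleton]
  have hvI (i : I) : v i = ∑ t, g (i, t) := by simp [v]
  have hvj : v j = ∑ p : I × T, c p.1 p.2 • g p := by simp [v, hjI]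
  have hvR {k : Fin r} (hk : k ∉ I ∧ k ≠ j) : v k = ind {θ k} := by simp [v, hk]
  have hθ {k : Fin r} (hk : k ∉ I ∧ k ≠ j) : θ k = e (.inr ⟨k, hk⟩) := dif_pos hk
  have hJR {k : Fin r} (hk : k ∈ J.erase j) : k ∉ I ∧ k ≠ j :=
    ⟨fun hkI => disjoint_left.1 hdisj hkI (mem_of_mem_erase hk), ne_of_mem_erase hk⟩
  have hcomp : α'.comp (basisLift v) = α := by
    refine addMonoidHom_ext_ind fun k => ?_
    rw [AddMonoidHom.comp_apply, basisLift_ind_singleton]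
    by_cases hkI : k ∈ I
    · rw [hvI ⟨k, hkI⟩, map_sum, hw ⟨k, hkI⟩]
      simp only [hα'g]
    · by_cases hkj : k = j
      · rw [hkj, hvj, map_sum, hy, Fintype.sum_prod_type]
        simp only [map_nsmul, hα'g]
      · rw [hvR ⟨hkI, hkj⟩, hθ ⟨hkI, hkj⟩]
        simp [α', basisLift_ind_singleton]
  have hβI : basisLift v (ind I) = ∑ p, g p := by
    rw [ind_eq_sum I, map_sum, ← sum_coe_sort I, Fintype.sum_prod_type]
    simp only [basisLift_ind_singleton, hvI]
  have hinj : Set.InjOn θ (J.erase j : Finset (Fin r)) := by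
    intro k hk l hl hkl
    rw [hθ (hJR hk), hθ (hJR hl)] at hkl
    exact congrArg Subtype.val (Sum.inr.inj (e.injective hkl))
  have hβθ : ∀ k ∈ J.erase j, basisLift v (ind {k}) = ind {θ k} := fun k hk => by
    rw [basisLift_ind_singleton, hvR (hJR hk)]
  have hK : basisLift v (ind I) = ind (univ.image fun p : I × T => e (.inl p)) := by
    rw [hβI, ind_eq_sum, sum_image]
    exact fun p _ q _ hpq => by simpa using hpq
  refine ⟨_, basisLift v, α', univ.image fun p : I × T => e (.inl p), θ, ?_, hcomp, hinj, ?_,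
    hβθ, ?_, hK, n, hn, ?_⟩
  · have hcard : (J.erase j).card ≤ Fintype.card R := by
      rw [Fintype.card_subtype]
      exact card_le_card fun k hk => by simpa using hJR hk
    rw [card_erase_of_mem hj] at hcard
    rw [Fintype.card_sum, Fintype.card_prod, Fintype.card_coe]
    have := Nat.mul_le_mul_left I.card hT
    omega
  · intro k hk
    rw [hθ (hJR hk)]
    simp
  · rw [basisLift_ind_singleton, hvj, hβI]
    exact propto_sum_smul _ _ _
  · have himg : ind ((J.erase j).image θ) = basisLift v (ind (J.erase j)) := by
      rw [ind_eq_sum, sum_image hinj, ind_eq_sum (J.erase j), map_sum]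
      exact sum_congr rfl fun k hk => (hβθ k hk).symm
    rw [himg, ← hK, ← AddMonoidHom.comp_apply, ← AddMonoidHom.comp_apply, hcomp]
    exact hle.add_left
end

section
/- Let Δ = (ℤ₊)^r be the simplicial monoid of rank r, let M be a refinement monoid, let α : Δ → M be a monoid homomorphism, and let I and J be nonempty disjoint subsets of {1, …, r} such that α(e_J) ∝ α(e_I) in M. Then there exist a natural number s and monoid homomorphisms β : (ℤ₊)^r → (ℤ₊)^s and α' : (ℤ₊)^s → M such that α' ∘ β = α (hence the range of α is contained in the range of α') and β(e_J) ∝ β(e_I) in (ℤ₊)^s. -/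
/-- Refining a decomposition into two summands against a nonempty finite sum. -/
theorem IsRefinement.exists_add_eq_sum {M κ : Type*} [AddCommMonoid M] (hM : IsRefinement M)
    {s : Finset κ} (hs : s.Nonempty) (y : κ → M) (a b : M) (h : a + b = ∑ k ∈ s, y k) :
    ∃ u v : κ → M, (∀ k ∈ s, y k = u k + v k) ∧ a = ∑ k ∈ s, u k ∧ b = ∑ k ∈ s, v k := by
  classical
  induction hs using Finset.Nonempty.cons_induction generalizing a b with
  | singleton k => exact ⟨fun _ => a, fun _ => b, by simpa using h.symm, by simp, by simp⟩
  | cons k s hk hs ih =>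
    rw [Finset.sum_cons] at h
    obtain ⟨z₁₁, z₁₂, z₂₁, z₂₂, rfl, rfl, h₁, h₂⟩ := hM _ _ _ _ h
    obtain ⟨u, v, huv, rfl, rfl⟩ := ih z₁₂ z₂₂ h₂.symm
    have hne : ∀ l ∈ s, l ≠ k := fun l hl e => hk (e ▸ hl)
    refine ⟨Function.update u k z₁₁, Function.update v k z₂₁, ?_, ?_, ?_⟩
    · intro l hl
      rcases Finset.mem_cons.1 hl with rfl | hl
      · simpa using h₁
      · simpa [hne l hl] using huv l hl
    · rw [Finset.sum_cons, Function.update_self]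
      exact congrArg _ (Finset.sum_congr rfl fun l hl => by simp [hne l hl])
    · rw [Finset.sum_cons, Function.update_self]
      exact congrArg _ (Finset.sum_congr rfl fun l hl => by simp [hne l hl])

/-- Two nonempty finite sums with the same value have a common refinement matrix. -/
theorem IsRefinement.exists_matrix {M ι κ : Type*} [AddCommMonoid M] (hM : IsRefinement M)
    {t : Finset ι} (ht : t.Nonempty) {s : Finset κ} (hs : s.Nonempty) (x : ι → M) (y : κ → M)
    (h : ∑ i ∈ t, x i = ∑ k ∈ s, y k) :
    ∃ z : ι → κ → M, (∀ i ∈ t, x i = ∑ k ∈ s, z i k) ∧ ∀ k ∈ s, y k = ∑ i ∈ t, z i k := by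
  classical
  induction ht using Finset.Nonempty.cons_induction generalizing y with
  | singleton i => exact ⟨fun _ => y, by simpa using h, by simp⟩
  | cons i t hi ht ih =>
    rw [Finset.sum_cons] at h
    obtain ⟨u, v, huv, hu, hv⟩ := hM.exists_add_eq_sum hs y _ _ h
    obtain ⟨z, hz₁, hz₂⟩ := ih v hv
    have hne : ∀ l ∈ t, l ≠ i := fun l hl e => hi (e ▸ hl)
    refine ⟨Function.update z i u, ?_, ?_⟩
    · intro l hl
      rcases Finset.mem_cons.1 hl with rfl | hl
      · simpa using hu
      · simpa [hne l hl] using hz₁ l hl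
    · intro k hk
      rw [Finset.sum_cons, Function.update_self, huv k hk, hz₂ k hk]
      exact congrArg _ (Finset.sum_congr rfl fun l hl => by simp [hne l hl])

/-- Finitely many decompositions of one element, all indexed by the same nonempty finite type,
have a common refinement. -/
theorem IsRefinement.exists_common_refinement {M κ : Type*} [AddCommMonoid M]
    (hM : IsRefinement M) [Fintype κ] [DecidableEq κ] [Nonempty κ] (a : M) (n : ℕ)
    (z : Fin n → κ → M) (h : ∀ k, a = ∑ j, z k j) :
    ∃ w : (Fin n → κ) → M, a = ∑ f, w f ∧ ∀ k j, z k j = ∑ f, if f k = j then w f else 0 := by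
  induction n with
  | zero => exact ⟨fun _ => a, by simp, fun k => k.elim0⟩
  | succ n ih =>
    obtain ⟨w, hw, hwz⟩ := ih (fun k => z k.succ) fun k => h k.succ
    obtain ⟨y, hy₁, hy₂⟩ := hM.exists_matrix Finset.univ_nonempty Finset.univ_nonempty (z 0) w
      ((h 0).symm.trans hw)
    have sum_cons (g : (Fin (n + 1) → κ) → M) : ∑ f, g f = ∑ j, ∑ f, g (Fin.cons j f) := by
      rw [← (Fin.consEquiv fun _ => κ).sum_comp, Fintype.sum_prod_type]
      rfl
    refine ⟨fun f => y (f 0) (Fin.tail f), ?_, fun k => ?_⟩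
    · rw [sum_cons, h 0]
      exact Finset.sum_congr rfl fun j hj => by simpa using hy₁ j hj
    · refine Fin.cases (fun j => ?_) (fun k j => ?_) k
      · rw [sum_cons, Finset.sum_eq_single j]
        · simpa using hy₁ j (Finset.mem_univ _)
        · intro l _ hl
          simp [hl]
        · simp
      · rw [sum_cons, Finset.sum_comm, hwz k j]
        refine Finset.sum_congr rfl fun f _ => ?_
        by_cases hf : f k = j
        · simpa [hf] using hy₂ f (Finset.mem_univ _)
        · simp [hf]

theorem ind_eq_sum_s4 {r : ℕ} (I : Finset (Fin r)) :
    ind I = ∑ i ∈ I, (Pi.single i 1 : Fin r → ℕ) := by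
  ext j
  simp [ind, Finset.sum_apply, Pi.single_apply]

/-- A homomorphism out of a simplicial monoid factors through `S → ℕ` as soon as the images of the
basis vectors are combinations of a family indexed by `S`. -/
theorem exists_factorization {M S : Type*} [AddCommMonoid M] [Fintype S] {r : ℕ}
    (α : (Fin r → ℕ) →+ M) (I J : Finset (Fin r)) (n : ℕ) (hn : 1 ≤ n)
    (B : Fin r → S → ℕ) (W : S → M) (hB : ∀ l, α (Pi.single l 1) = ∑ x, B l x • W x)
    (hle : ∀ x, ∑ l ∈ J, B l x ≤ n * ∑ l ∈ I, B l x) :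
    ∃ (s : ℕ) (β : (Fin r → ℕ) →+ (Fin s → ℕ)) (α' : (Fin s → ℕ) →+ M),
      α'.comp β = α ∧ Propto (β (ind J)) (β (ind I)) := by
  let e := Fintype.equivFin S
  let β : (Fin r → ℕ) →ₗ[ℕ] (Fin (Fintype.card S) → ℕ) :=
    Fintype.linearCombination ℕ fun l => B l ∘ e.symm
  let α' : (Fin (Fintype.card S) → ℕ) →ₗ[ℕ] M := Fintype.linearCombination ℕ (W ∘ e.symm)
  have hβ (l : Fin r) : β (Pi.single l 1) = B l ∘ e.symm := by
    simp [β, Fintype.linearCombination_apply_single]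
  refine ⟨_, β.toAddMonoidHom, α'.toAddMonoidHom, ?_, n, hn, ?_⟩
  · have key : α'.comp β = α.toNatLinearMap := by
      refine LinearMap.pi_ext' fun l => LinearMap.ext_ring ?_
      simp only [LinearMap.comp_apply, LinearMap.single_apply, hβ]
      simpa [α', Fintype.linearCombination_apply, hB] using
        e.symm.sum_comp fun x => B l x • W x
    exact AddMonoidHom.ext fun v => LinearMap.congr_fun key v
  · have hle' : β (ind J) ≤ n • β (ind I) := by
      intro x
      simpa [ind_eq_sum_s4, map_sum, hβ] using hle (e.symm x)
    obtain ⟨c, hc⟩ := exists_add_of_le hle'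
    exact ⟨c, hc.symm⟩

theorem stmt_4 {M : Type*} [AddCommMonoid M] (r : ℕ)
    (hM : IsRefinement M) (α : (Fin r → ℕ) →+ M)
    (I J : Finset (Fin r)) (hI : I.Nonempty) (hJ : J.Nonempty)
    (hdisj : Disjoint I J)
    (h : Propto (α (ind J)) (α (ind I))) :
    ∃ (s : ℕ) (β : (Fin r → ℕ) →+ (Fin s → ℕ)) (α' : (Fin s → ℕ) →+ M),
      α'.comp β = α ∧
      Propto (β (ind J)) (β (ind I)) := by
  obtain ⟨n, hn, c, hc⟩ := h
  let a (l : Fin r) : M := α (Pi.single l 1)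
  have hα (K : Finset (Fin r)) : α (ind K) = ∑ l ∈ K, a l := by rw [ind_eq_sum_s4, map_sum]
  have : Nonempty I := hI.to_subtype
  have : NeZero n := ⟨by omega⟩
  have hsum : ∑ j : Option J, j.elim c (fun j => a j) = ∑ p : I × Fin n, a p.1 := by
    rw [Fintype.sum_option, Fintype.sum_prod_type]
    simp only [Option.elim_none, Option.elim_some, Finset.sum_const, Finset.card_univ,
      Fintype.card_fin, ← Finset.smul_sum]
    rw [Finset.sum_coe_sort J a, Finset.sum_coe_sort I a, ← hα, ← hα, add_comm, hc]
  obtain ⟨z, hz₁, hz₂⟩ :=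
    hM.exists_matrix Finset.univ_nonempty Finset.univ_nonempty _ _ hsum
  choose w hw hwz using fun i : I => hM.exists_common_refinement (a i) n (fun k j => z j (i, k))
    fun k => hz₂ (i, k) (Finset.mem_univ _)
  let B (l : Fin r) : (I × (Fin n → Option J)) ⊕ Fin r → ℕ :=
    if l ∈ I then Sum.elim (fun p => if l = p.1 then 1 else 0) 0
    else if l ∈ J then
      Sum.elim (fun p => ∑ k, if (p.2 k).map Subtype.val = some l then 1 else 0) 0
    else Sum.elim 0 (Pi.single l 1)
  have hBI {l} (hl : l ∈ I) : B l = Sum.elim (fun p => if l = p.1 then 1 else 0) 0 := if_pos hl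
  have hBJ {l} (hl : l ∈ J) : B l =
      Sum.elim (fun p => ∑ k, if (p.2 k).map Subtype.val = some l then 1 else 0) 0 :=
    (if_neg fun h => Finset.disjoint_left.1 hdisj h hl).trans (if_pos hl)
  refine exists_factorization α I J n hn B (Sum.elim (fun p => w p.1 p.2) a) (fun l => ?_) ?_
  · rw [Fintype.sum_sum_type, Fintype.sum_prod_type]
    by_cases hlI : l ∈ I
    · rw [hBI hlI, Finset.sum_eq_single ⟨l, hlI⟩]
      · simpa using hw ⟨l, hlI⟩
      · intro i _ hi
        have : l ≠ i := fun e => hi (Subtype.ext e.symm)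
        simp [this]
      · simp
    by_cases hlJ : l ∈ J
    · have hmap (o : Option J) : o.map Subtype.val = some l ↔ o = some ⟨l, hlJ⟩ := by
        cases o <;> simp [Subtype.ext_iff]
      have := hz₁ (some ⟨l, hlJ⟩) (Finset.mem_univ _)
      rw [Fintype.sum_prod_type] at this
      simp only [hwz] at this
      simp only [hBJ hlJ, Sum.elim_inl, Sum.elim_inr, Pi.zero_apply, zero_smul,
        Finset.sum_const_zero, add_zero, hmap, Finset.sum_smul, ite_smul, one_smul]
      refine this.trans (Finset.sum_congr rfl fun i _ => Finset.sum_comm)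
    · simp [B, hlI, hlJ, Pi.single_apply, a]
  · rintro (⟨i, f⟩ | l)
    · rw [Finset.sum_congr rfl fun l hl => congrFun (hBJ hl) _,
        Finset.sum_congr rfl fun l hl => congrFun (hBI hl) _]
      simp only [Sum.elim_inl, Finset.sum_ite_eq', i.2, if_true, mul_one]
      rw [Finset.sum_comm]
      calc _ ≤ ∑ _k : Fin n, 1 := Finset.sum_le_sum fun k _ => ?_
        _ = n := by simp
      rw [← Finset.card_filter]
      refine Finset.card_le_one.2 fun x hx y hy => Option.some_injective _ ?_
      exact (Finset.mem_filter.1 hx).2.symm.trans (Finset.mem_filter.1 hy).2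
    · rw [Finset.sum_congr rfl fun l hl => congrFun (hBJ hl) _]
      simp
end

section
/- Let Δ = (ℤ₊)^r be the simplicial monoid of rank r, let M be an additive commutative monoid, and let α : Δ → M be a monoid homomorphism. For elements x and y in Δ with J = supp(x) and I = supp(y), the following conditions are equivalent: (i) α(x) ∝ α(y); (ii) α(e_J) ∝ α(e_I); (iii) α(e_{J∖I}) ∝ α(e_I). -/
/-- The support of an element of the simplicial monoid `(ℤ₊)^r`. -/
def fsupp {n : ℕ} (x : Fin n → ℕ) : Finset (Fin n) :=
  Finset.univ.filter (fun j => x j ≠ 0)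

namespace Propto

variable {M : Type*} [AddCommMonoid M]

theorem refl_s5 (x : M) : Propto x x := ⟨1, le_rfl, 0, by simp⟩

theorem trans {x y z : M} : Propto x y → Propto y z → Propto x z := by
  rintro ⟨n, hn, u, hu⟩ ⟨m, hm, v, hv⟩
  exact ⟨n * m, Nat.mul_pos hn hm, u + n • v, by rw [← add_assoc, hu, ← nsmul_add, hv, mul_nsmul']⟩

theorem add {x y z : M} : Propto x z → Propto y z → Propto (x + y) z := by
  rintro ⟨n, hn, u, hu⟩ ⟨m, hm, v, hv⟩
  exact ⟨n + m, Nat.add_pos_left hn m, u + v, by rw [add_add_add_comm, hu, hv, add_nsmul]⟩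

/-- If the support of `x` lies in that of `y`, then `α x ∝ α y`. -/
theorem map_of_support {r : ℕ} (α : (Fin r → ℕ) →+ M) {x y : Fin r → ℕ}
    (h : ∀ j, x j ≠ 0 → y j ≠ 0) : Propto (α x) (α y) := by
  have hle : x ≤ (1 + ∑ j, x j) • y := by
    intro j
    rw [Pi.smul_apply, smul_eq_mul]
    by_cases hx : x j = 0
    · simp [hx]
    · calc x j ≤ ∑ i, x i := Finset.single_le_sum (fun _ _ => Nat.zero_le _) (Finset.mem_univ j)
        _ ≤ 1 + ∑ i, x i := Nat.le_add_left _ _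
        _ ≤ (1 + ∑ i, x i) * y j := Nat.le_mul_of_pos_right _ (Nat.pos_of_ne_zero (h j hx))
  obtain ⟨z, hz⟩ := exists_add_of_le hle
  exact ⟨1 + ∑ j, x j, Nat.le_add_right _ _, α z, by rw [← map_add, ← hz, map_nsmul]⟩

end Propto

theorem stmt_5 {M : Type*} [AddCommMonoid M] (r : ℕ)
    (α : (Fin r → ℕ) →+ M) (x y : Fin r → ℕ)
    (J : Finset (Fin r)) (I : Finset (Fin r))
    (hJ : J = fsupp x) (hI : I = fsupp y) :
    (Propto (α x) (α y) ↔ Propto (α (ind J)) (α (ind I))) ∧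
    (Propto (α (ind J)) (α (ind I)) ↔ Propto (α (ind (J \ I))) (α (ind I))) := by
  subst hJ hI
  have hx : Propto (α x) (α (ind (fsupp x))) :=
    Propto.map_of_support α fun j hj => by simpa [ind, fsupp] using hj
  have hx' : Propto (α (ind (fsupp x))) (α x) :=
    Propto.map_of_support α fun j hj => by simpa [ind, fsupp] using hj
  have hy : Propto (α y) (α (ind (fsupp y))) :=
    Propto.map_of_support α fun j hj => by simpa [ind, fsupp] using hj
  have hy' : Propto (α (ind (fsupp y))) (α y) :=
    Propto.map_of_support α fun j hj => by simpa [ind, fsupp] using hj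
  have hsdiff : Propto (α (ind (fsupp x \ fsupp y))) (α (ind (fsupp x))) :=
    Propto.map_of_support α fun j hj => by simp_all [ind]
  have hunion : Propto (α (ind (fsupp x)))
      (α (ind (fsupp x \ fsupp y)) + α (ind (fsupp y))) := by
    rw [← map_add]
    refine Propto.map_of_support α fun j hj => ?_
    by_cases hI : j ∈ fsupp y <;> simp_all [ind]
  exact ⟨⟨fun h => (hx'.trans h).trans hy, fun h => (hx.trans h).trans hy'⟩,
    ⟨fun h => hsdiff.trans h, fun h => hunion.trans (h.add (.refl _))⟩⟩
end

section
/- Let Δ = (ℤ₊)^r be the simplicial monoid of rank r, let M be a conical refinement monoid, let α : Δ → M be a monoid homomorphism, and let x, y ∈ Δ satisfy α(x) ∝ α(y) in M. Then there exist a natural number s and monoid homomorphisms β : (ℤ₊)^r → (ℤ₊)^s and α' : (ℤ₊)^s → M such that α' ∘ β = α (hence the range of α is contained in the range of α') and β(x) ∝ β(y) in (ℤ₊)^s. -/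
/-- A conical monoid: `x + y = 0` implies `x = y = 0`. -/
def IsConical (M : Type*) [AddCommMonoid M] : Prop :=
  ∀ x y : M, x + y = 0 → x = 0 ∧ y = 0

theorem AlgLE.trans {M : Type*} [AddCommMonoid M] {a b c : M} (hab : AlgLE a b)
    (hbc : AlgLE b c) : AlgLE a c := by
  obtain ⟨u, rfl⟩ := hab
  obtain ⟨v, rfl⟩ := hbc
  exact ⟨u + v, (add_assoc _ _ _).symm⟩

/-- An element below a finite sum is a sum of elements below the summands. -/
theorem IsRefinement.exists_eq_sum_of_algLE {M : Type*} [AddCommMonoid M]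
    (hM : IsRefinement M) (hC : IsConical M) {L : Type*} (p : L → M) (s : Finset L) :
    ∀ b : M, AlgLE b (∑ l ∈ s, p l) →
      ∃ u v : L → M, (∀ l ∈ s, p l = u l + v l) ∧ b = ∑ l ∈ s, u l := by
  classical
  induction s using Finset.induction_on with
  | empty =>
    rintro b ⟨c, hc⟩
    refine ⟨0, 0, by simp, ?_⟩
    simpa using (hC b c (by simpa using hc)).1
  | insert i s hi ih =>
    rintro b ⟨c, hc⟩
    rw [Finset.sum_insert hi] at hc
    obtain ⟨z₁, z₂, w₁, w₂, hb, -, hp, hs⟩ := hM _ _ _ _ hc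
    obtain ⟨u, v, huv, hu⟩ := ih z₂ ⟨w₂, hs.symm⟩
    refine ⟨Function.update u i z₁, Function.update v i w₁, ?_, ?_⟩
    · intro l hl
      rcases Finset.mem_insert.1 hl with rfl | hl
      · simpa using hp
      · have hne : l ≠ i := fun h => hi (h ▸ hl)
        simpa [hne] using huv l hl
    · rw [Finset.sum_insert hi, Finset.sum_update_of_notMem hi, hb, hu]
      simp

/-- An element below a multiple of `e` is a sum of elements below `e`. -/
theorem IsRefinement.exists_list_sum_of_propto {M : Type*} [AddCommMonoid M]
    (hM : IsRefinement M) (hC : IsConical M) {b e : M} (h : Propto b e) :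
    ∃ cs : List M, (∀ c ∈ cs, AlgLE c e) ∧ cs.sum = b := by
  obtain ⟨n, -, h⟩ := h
  obtain ⟨u, v, huv, hu⟩ :=
    hM.exists_eq_sum_of_algLE hC (fun _ : Fin n => e) Finset.univ b (by simpa using h)
  refine ⟨List.ofFn u, fun c hc => ?_, by rw [List.sum_ofFn, hu]⟩
  obtain ⟨i, rfl⟩ := (List.mem_ofFn' _ _).1 hc
  exact ⟨v i, (huv i (Finset.mem_univ i)).symm⟩

/-- A finite family `a` can be subdivided so that each of finitely many given elements below its
sum becomes a sum of pieces. -/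
theorem IsRefinement.exists_subdivision_of_algLE {M : Type*} [AddCommMonoid M]
    (hM : IsRefinement M) (hC : IsConical M) {J : Type} [Fintype J] [DecidableEq J] (a : J → M)
    (bs : List M) (hbs : ∀ b ∈ bs, AlgLE b (∑ j, a j)) :
    ∃ (L : Type) (_ : Fintype L) (f : L → J) (p : L → M),
      (∀ j, a j = ∑ l, if f l = j then p l else 0) ∧
        ∀ b ∈ bs, b ∈ AddSubmonoid.closure (Set.range p) := by
  induction bs with
  | nil => exact ⟨J, inferInstance, id, a, by simp, by simp⟩
  | cons b bs ih =>
    obtain ⟨L, _, f, p, hp, hc⟩ := ih fun b hb => hbs b (List.mem_cons_of_mem _ hb)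
    have hsum : ∑ j, a j = ∑ l, p l := by
      simp_rw [hp]
      rw [Finset.sum_comm]
      simp
    obtain ⟨u, v, huv, hu⟩ := hM.exists_eq_sum_of_algLE hC p Finset.univ b
      (hsum ▸ hbs b List.mem_cons_self)
    have hmem (l : L ⊕ L) : Sum.elim u v l ∈
        AddSubmonoid.closure (Set.range (Sum.elim u v)) :=
      AddSubmonoid.subset_closure ⟨l, rfl⟩
    refine ⟨L ⊕ L, inferInstance, Sum.elim f f, Sum.elim u v, fun j => ?_, fun d hd => ?_⟩
    · rw [hp j, Fintype.sum_sum_type, ← Finset.sum_add_distrib]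
      refine Finset.sum_congr rfl fun l hl => ?_
      by_cases h : f l = j <;> simp [h, huv l hl]
    · rcases List.mem_cons.1 hd with rfl | hd
      · rw [hu]
        exact sum_mem fun l _ => hmem (Sum.inl l)
      · refine (AddSubmonoid.closure_le (S := AddSubmonoid.closure _)).2 ?_ (hc d hd)
        rintro _ ⟨l, rfl⟩
        rw [huv l (Finset.mem_univ l)]
        exact add_mem (hmem (Sum.inl l)) (hmem (Sum.inr l))

/-- The version of `IsRefinement.exists_subdivision_of_algLE` for elements below multiples of the
sum. -/
theorem IsRefinement.exists_subdivision_of_propto {M : Type*} [AddCommMonoid M]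
    (hM : IsRefinement M) (hC : IsConical M) {J : Type} [Fintype J] [DecidableEq J] (a : J → M)
    (bs : List M) (hbs : ∀ b ∈ bs, Propto b (∑ j, a j)) :
    ∃ (L : Type) (_ : Fintype L) (f : L → J) (p : L → M),
      (∀ j, a j = ∑ l, if f l = j then p l else 0) ∧
        ∀ b ∈ bs, b ∈ AddSubmonoid.closure (Set.range p) := by
  have key (b : M) (hb : Propto b (∑ j, a j)) := hM.exists_list_sum_of_propto hC hb
  choose! g hg hgsum using key
  obtain ⟨L, hL, f, p, hp, hc⟩ := hM.exists_subdivision_of_algLE hC a (bs.flatMap g) (by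
    intro c h
    obtain ⟨b, hb, hcb⟩ := List.mem_flatMap.1 h
    exact hg b (hbs b hb) c hcb)
  refine ⟨L, hL, f, p, hp, fun b hb => ?_⟩
  rw [← hgsum b (hbs b hb)]
  exact list_sum_mem fun c h => hc c (List.mem_flatMap.2 ⟨b, hb, h⟩)

theorem propto_of_support {K : Type*} [Fintype K] {x y : K → ℕ}
    (h : ∀ k, x k ≠ 0 → y k ≠ 0) : Propto x y := by
  refine ⟨∑ k, x k + 1, by omega, ((∑ k, x k + 1) • y) - x, ?_⟩
  refine add_tsub_cancel_of_le fun k => ?_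
  have hle : x k ≤ ∑ k, x k := Finset.single_le_sum (fun _ _ => Nat.zero_le _) (Finset.mem_univ k)
  rcases Nat.eq_zero_or_pos (x k) with h0 | h0
  · simp [h0]
  · have := Nat.pos_of_ne_zero (h k h0.ne')
    simp only [Pi.smul_apply, smul_eq_mul]
    nlinarith

/-- The homomorphism out of a simplicial monoid sending the basis to a given family. -/
def simplicialLift {K M : Type*} [Fintype K] [AddCommMonoid M] (q : K → M) : (K → ℕ) →+ M where
  toFun g := ∑ k, g k • q k
  map_zero' := by simp
  map_add' g h := by simp [add_smul, Finset.sum_add_distrib]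

theorem simplicialLift_apply {K M : Type*} [Fintype K] [AddCommMonoid M] (q : K → M)
    (g : K → ℕ) : simplicialLift q g = ∑ k, g k • q k := rfl

theorem simplicialLift_single {K M : Type*} [Fintype K] [DecidableEq K] [AddCommMonoid M]
    (q : K → M) (k : K) : simplicialLift q (Pi.single k 1) = q k := by
  simp [simplicialLift_apply, Pi.single_apply, ite_smul]

theorem eq_simplicialLift {K M : Type*} [Fintype K] [DecidableEq K] [AddCommMonoid M]
    (α : (K → ℕ) →+ M) : α = simplicialLift fun k => α (Pi.single k 1) := by
  refine AddMonoidHom.functions_ext' _ _ _ fun k => ?_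
  ext
  simp [simplicialLift_single]

/-- A factorization through a simplicial monoid is determined by a coefficient matrix. -/
theorem exists_factorization_of_matrix {M : Type*} [AddCommMonoid M] {r : ℕ}
    (α : (Fin r → ℕ) →+ M) (x y : Fin r → ℕ) {K : Type*} [Fintype K] (q : K → M)
    (B : Fin r → K → ℕ) (hB : ∀ i, ∑ k, B i k • q k = α (Pi.single i 1))
    (hxy : ∀ i, x i ≠ 0 → ∀ k, B i k ≠ 0 → ∃ j, y j ≠ 0 ∧ B j k ≠ 0) :
    ∃ (s : ℕ) (β : (Fin r → ℕ) →+ (Fin s → ℕ)) (α' : (Fin s → ℕ) →+ M),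
      α'.comp β = α ∧ Propto (β x) (β y) := by
  let e := Fintype.equivFin K
  refine ⟨Fintype.card K, simplicialLift fun i => B i ∘ e.symm, simplicialLift (q ∘ e.symm),
    ?_, ?_⟩
  · refine AddMonoidHom.functions_ext' _ _ _ fun i => ?_
    ext
    simp only [AddMonoidHom.comp_apply, AddMonoidHom.single_apply, simplicialLift_single]
    rw [← hB i, simplicialLift_apply]
    exact e.symm.sum_comp fun k => B i k • q k
  · refine propto_of_support fun k hk => ?_
    simp only [simplicialLift_apply, Finset.sum_apply, Pi.smul_apply, Function.comp_apply,
      smul_eq_mul, ne_eq, Finset.sum_eq_zero_iff, Finset.mem_univ, true_imp_iff,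
      mul_eq_zero, not_forall, not_or] at hk ⊢
    obtain ⟨i, hx, hi⟩ := hk
    exact hxy i hx _ hi

theorem stmt_6 {M : Type*} [AddCommMonoid M] (r : ℕ)
    (hC : IsConical M) (hM : IsRefinement M) (α : (Fin r → ℕ) →+ M)
    (x y : Fin r → ℕ) (h : Propto (α x) (α y)) :
    ∃ (s : ℕ) (β : (Fin r → ℕ) →+ (Fin s → ℕ)) (α' : (Fin s → ℕ) →+ M),
      α'.comp β = α ∧
      Propto (β x) (β y) := by
  classical
  let a (i : Fin r) : M := α (Pi.single i 1)
  have hα (g : Fin r → ℕ) : α g = ∑ i, g i • a i := by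
    rw [eq_simplicialLift α, simplicialLift_apply]
  let J := {j : Fin r // y j ≠ 0}
  have hy : AlgLE (α y) ((∑ i, y i + 1) • ∑ j : J, a j) := by
    have hsum : α y = ∑ j : J, y j • a j := by
      rw [hα, ← Finset.sum_subtype (Finset.univ.filter fun j => y j ≠ 0) (by simp)
        (fun j => y j • a j), Finset.sum_filter_of_ne]
      rintro i - hi h0
      simp [h0] at hi
    refine ⟨∑ j : J, ((∑ i, y i + 1) - y j) • a j, ?_⟩
    rw [hsum, ← Finset.sum_add_distrib, Finset.smul_sum]
    refine Finset.sum_congr rfl fun j _ => ?_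
    have hle : y j ≤ ∑ i, y i :=
      Finset.single_le_sum (fun _ _ => Nat.zero_le _) (Finset.mem_univ j.1)
    rw [← add_smul]
    congr 1
    omega
  have hx (i : Fin r) (hi : x i ≠ 0) : Propto (a i) (∑ j : J, a j) := by
    obtain ⟨n, hn, hxy⟩ := h
    obtain ⟨z, hz⟩ := hy
    obtain ⟨m, hm⟩ := Nat.exists_eq_succ_of_ne_zero hi
    have hix : AlgLE (a i) (α x) := by
      refine ⟨m • a i + ∑ l ∈ Finset.univ.erase i, x l • a l, ?_⟩
      rw [hα, ← Finset.add_sum_erase _ _ (Finset.mem_univ i), hm, Nat.succ_eq_add_one, add_smul,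
        one_smul]
      abel
    refine ⟨n * (∑ i, y i + 1), Nat.mul_pos hn (Nat.succ_pos _), (hix.trans hxy).trans ?_⟩
    exact ⟨n • z, by rw [← smul_add, hz, mul_smul]⟩
  obtain ⟨L, _, f, p, hp, hc⟩ := hM.exists_subdivision_of_propto hC (fun j : J => a j)
    (((List.finRange r).filter fun i => x i ≠ 0).map a) (by
      intro b hb
      obtain ⟨i, hi, rfl⟩ := List.mem_map.1 hb
      exact hx i (by simpa using hi))
  have hcoef (i : Fin r) (hi : x i ≠ 0) : ∃ c : L → ℕ, a i = ∑ l, c l • p l := by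
    have hmem := hc (a i) (List.mem_map.2 ⟨i, by simpa using hi, rfl⟩)
    exact AddSubmonoid.mem_closure_range_iff_of_fintype.1 hmem
  choose! C hCa using hcoef
  refine exists_factorization_of_matrix α x y (Sum.elim p a)
    (fun i => if y i ≠ 0 then Sum.elim (fun l => if (f l).1 = i then 1 else 0) 0
      else if x i ≠ 0 then Sum.elim (C i) 0 else Sum.elim 0 (Pi.single i 1)) ?_ ?_
  · intro i
    change _ = a i
    rw [Fintype.sum_sum_type]
    by_cases hyi : y i = 0
    · by_cases hxi : x i = 0
      · simp [hyi, hxi, Pi.single_apply, ite_smul]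
      · simpa [hyi, hxi] using (hCa i hxi).symm
    · have hf (l : L) : (f l).1 = i ↔ f l = ⟨i, hyi⟩ :=
        ⟨fun h => Subtype.ext h, congrArg Subtype.val⟩
      simpa [hyi, ite_smul, hf] using (hp ⟨i, hyi⟩).symm
  · rintro i hxi (l | l) hk
    · exact ⟨f l, (f l).2, by simp [(f l).2]⟩
    · by_cases hyi : y i = 0 <;> simp [hyi, hxi] at hk
end

section
/- Let Δ = (ℤ₊)^r be the simplicial monoid of rank r, let M be a conical refinement monoid, and let α : Δ → M be a monoid homomorphism. Then there exist a natural number s and monoid homomorphisms β : (ℤ₊)^r → (ℤ₊)^s and α' : (ℤ₊)^s → M such that α' ∘ β = α (hence the range of α is contained in the range of α') and such that β(x) ∝ β(y) in (ℤ₊)^s whenever x and y are elements of (ℤ₊)^r with α(x) ∝ α(y) in M. -/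
open Finset

section Propto

variable {M N : Type*} [AddCommMonoid M] [AddCommMonoid N]

lemma Propto.map (f : M →+ N) {x y : M} (h : Propto x y) : Propto (f x) (f y) := by
  obtain ⟨n, hn, z, hz⟩ := h
  exact ⟨n, hn, f z, by rw [← map_add, hz, map_nsmul]⟩

lemma Propto.trans_s7 {x y z : M} (hxy : Propto x y) (hyz : Propto y z) : Propto x z := by
  obtain ⟨m, hm, u, hu⟩ := hxy
  obtain ⟨n, hn, v, hv⟩ := hyz
  refine ⟨m * n, Nat.mul_pos hm hn, u + m • v, ?_⟩
  rw [mul_nsmul', ← hv, nsmul_add, ← hu, add_assoc]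

lemma propto_of_forall_ne_zero {ι : Type*} [Fintype ι] {x y : ι → ℕ}
    (h : ∀ i, x i ≠ 0 → y i ≠ 0) : Propto x y := by
  refine ⟨∑ i, x i + 1, by omega, (∑ i, x i + 1) • y - x, ?_⟩
  refine add_tsub_cancel_of_le fun i ↦ ?_
  have hi : x i ≤ ∑ j, x j := single_le_sum (fun _ _ ↦ Nat.zero_le _) (mem_univ i)
  rcases Nat.eq_zero_or_pos (x i) with h0 | h0
  · simp [h0]
  · have := Nat.pos_of_ne_zero (h i h0.ne')
    simp only [Pi.smul_apply, smul_eq_mul]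
    nlinarith

lemma Propto.apply_of_ne_zero {x : M} {ι : Type*} [Fintype ι] [DecidableEq ι]
    (α : (ι → ℕ) →+ M) {y : ι → ℕ} (h : Propto (α y) x) {i : ι} (hi : y i ≠ 0) :
    Propto (α (Pi.single i 1)) x := by
  refine Propto.trans_s7 (Propto.map α (propto_of_forall_ne_zero fun j hj ↦ ?_)) h
  obtain rfl : j = i := by by_contra hne; simp [hne] at hj
  exact hi

end Propto

namespace IsRefinement

variable {M : Type*} [AddCommMonoid M]

/-- The Riesz decomposition property for finite sums. -/
lemma exists_eq_sum_of_le_sum (hM : IsRefinement M) (hC : IsConical M) {ι : Type*}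
    (J : Finset ι) (f : ι → M) (c : M) (h : AlgLE c (∑ j ∈ J, f j)) :
    ∃ g : ι → M, c = ∑ j ∈ J, g j ∧ ∀ j ∈ J, AlgLE (g j) (f j) := by
  classical
  induction J using Finset.induction_on generalizing c with
  | empty =>
    obtain ⟨z, hz⟩ := h
    exact ⟨fun _ ↦ 0, by simpa using (hC c z (by simpa using hz)).1, by simp⟩
  | insert i J hi ih =>
    obtain ⟨z, hz⟩ := h
    rw [sum_insert hi] at hz
    obtain ⟨p, q, s, t, rfl, -, hp, hq⟩ := hM _ _ _ _ hz
    obtain ⟨g, rfl, hg⟩ := ih q ⟨t, hq.symm⟩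
    have hne : ∀ j ∈ J, j ≠ i := fun j hj hji ↦ hi (hji ▸ hj)
    refine ⟨Function.update g i p, ?_, fun j hj ↦ ?_⟩
    · rw [sum_insert hi, Function.update_self]
      congr 1
      exact sum_congr rfl fun j hj ↦ by rw [Function.update_of_ne (hne j hj)]
    · rcases mem_insert.1 hj with rfl | hj
      · rw [Function.update_self]
        exact ⟨s, hp.symm⟩
      · rw [Function.update_of_ne (hne j hj)]
        exact hg j hj

/-- If `c ≤ n • a`, then `a = d₀ + ⋯ + dₙ` and `c = d₁ + 2 d₂ + ⋯ + n dₙ` for suitable `dₖ`. -/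
lemma exists_eq_sum_nsmul_of_le_nsmul (hM : IsRefinement M) (hC : IsConical M) (n : ℕ)
    (c a : M) (h : AlgLE c (n • a)) :
    ∃ d : ℕ → M, a = ∑ k ∈ range (n + 1), d k ∧ c = ∑ k ∈ range (n + 1), k • d k := by
  induction n generalizing c a with
  | zero =>
    obtain ⟨z, hz⟩ := h
    exact ⟨fun _ ↦ a, by simp, by simpa using (hC c z (by simpa using hz)).1⟩
  | succ n ih =>
    obtain ⟨z, hz⟩ := h
    rw [succ_nsmul'] at hz
    obtain ⟨p, q, s, t, rfl, -, rfl, hq⟩ := hM _ _ _ _ hz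
    rw [nsmul_add] at hq
    obtain ⟨q₁, t₁, q₂, t₂, hq₁, hq₂, rfl, -⟩ := hM _ _ _ _ hq
    obtain ⟨f, hpf, hqf⟩ := ih q₁ p ⟨t₁, hq₁.symm⟩
    obtain ⟨g, hsg, hqg⟩ := ih q₂ s ⟨t₂, hq₂.symm⟩
    let f' : ℕ → M := fun k ↦ Nat.casesOn k 0 f
    let g' : ℕ → M := fun k ↦ if k ≤ n then g k else 0
    have hg' : ∀ k ∈ range (n + 1), g' k = g k := fun k hk ↦
      if_pos (Nat.lt_succ_iff.1 (mem_range.1 hk))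
    have hgn : g' (n + 1) = 0 := if_neg (by omega)
    have hkg' : ∑ k ∈ range (n + 1), k • g' k = ∑ k ∈ range (n + 1), k • g k :=
      sum_congr rfl fun k hk ↦ by rw [hg' k hk]
    refine ⟨fun k ↦ f' k + g' k, ?_, ?_⟩
    · rw [sum_add_distrib, sum_range_succ' f', sum_range_succ g', hgn, sum_congr rfl hg', ← hsg]
      simp [f', ← hpf]
    · simp only [nsmul_add]
      rw [sum_add_distrib, sum_range_succ' (fun k ↦ k • f' k), sum_range_succ (fun k ↦ k • g' k),
        hgn, hkg', ← hqg]
      simp only [f', succ_nsmul, sum_add_distrib, ← hqf, ← hpf, nsmul_zero, zero_nsmul, add_zero]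
      abel

/-- If finitely many elements `a i`, `i ∈ I`, satisfy `a i ∝ ∑ j ∈ J, a j`, there is a finite
family `d` such that all `a l`, `l ∈ I ∪ J`, are combinations of `d`, with every member of `d`
occurring in some `a j`, `j ∈ J`. -/
lemma exists_common_refinement_s7 (hM : IsRefinement M) (hC : IsConical M) {ι : Type}
    (a : ι → M) (J I : Finset ι) (h : ∀ i ∈ I, Propto (a i) (∑ j ∈ J, a j)) :
    ∃ (κ : Type) (_ : Fintype κ) (d : κ → M) (B : ι → κ → ℕ),
      (∀ l, l ∈ I ∨ l ∈ J → a l = ∑ k, B l k • d k) ∧ ∀ k, ∃ j ∈ J, B j k ≠ 0 := by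
  classical
  induction I using Finset.induction_on with
  | empty =>
    refine ⟨J, inferInstance, fun k ↦ a k, fun l k ↦ if (k : ι) = l then 1 else 0, ?_,
      fun k ↦ ⟨k, k.2, by simp⟩⟩
    intro l hl
    have hl : l ∈ J := by simpa using hl
    rw [sum_coe_sort J fun k ↦ (if k = l then 1 else 0) • a k]
    simp [ite_smul, hl]
  | insert i I hi ih =>
    obtain ⟨κ, _, d, B, hB, hJ⟩ := ih fun l hl ↦ h l (mem_insert_of_mem hl)
    by_cases hiJ : i ∈ J
    · refine ⟨κ, inferInstance, d, B, fun l hl ↦ hB l ?_, hJ⟩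
      rcases hl with hl | hl
      · rcases mem_insert.1 hl with rfl | hl
        exacts [Or.inr hiJ, Or.inl hl]
      · exact Or.inr hl
    have hd : Propto (a i) (∑ k, d k) := by
      refine (h i (mem_insert_self i I)).trans_s7 ?_
      have key := Propto.map (Fintype.linearCombination ℕ d).toAddMonoidHom
        (propto_of_forall_ne_zero (x := ∑ j ∈ J, B j) (y := 1) (by simp))
      simp only [LinearMap.toAddMonoidHom_coe, map_sum, Fintype.linearCombination_apply,
        Pi.one_apply, one_smul] at key
      rwa [sum_congr rfl fun j hj ↦ hB j (Or.inr hj)]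
    obtain ⟨n, -, hn⟩ := hd
    rw [← sum_nsmul] at hn
    obtain ⟨c, hc, hcd⟩ := hM.exists_eq_sum_of_le_sum hC univ _ _ hn
    choose e hde hce using fun k ↦
      hM.exists_eq_sum_nsmul_of_le_nsmul hC n (c k) (d k) (hcd k (mem_univ k))
    refine ⟨κ × Fin (n + 1), inferInstance, fun k ↦ e k.1 k.2,
      fun l k ↦ if l = i then k.2 else B l k.1, fun l hl ↦ ?_, fun k ↦ ?_⟩
    · rw [Fintype.sum_prod_type]
      by_cases hli : l = i
      · subst hli
        simp only [if_true]
        rw [hc]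
        refine sum_congr rfl fun k _ ↦ ?_
        rw [hce k, sum_range]
      · simp only [hli, if_false]
        rw [hB l (hl.imp_left fun hl ↦ (mem_insert.1 hl).resolve_left hli)]
        refine sum_congr rfl fun k _ ↦ ?_
        rw [← smul_sum, ← sum_range (fun t ↦ e k t), ← hde k]
    · obtain ⟨j, hj, hjk⟩ := hJ k.1
      have hji : j ≠ i := fun hji ↦ hiJ (hji ▸ hj)
      exact ⟨j, hj, by simpa only [hji, if_false] using hjk⟩

/-- A single relation `α x ∝ α y` can be lifted to a simplicial monoid. -/
lemma exists_factor_propto (hM : IsRefinement M) (hC : IsConical M) {ι : Type} [Fintype ι]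
    (α : (ι → ℕ) →+ M) (x y : ι → ℕ) (h : Propto (α x) (α y)) :
    ∃ (κ : Type) (_ : Fintype κ) (β : (ι → ℕ) →+ (κ → ℕ)) (α' : (κ → ℕ) →+ M),
      α'.comp β = α ∧ Propto (β x) (β y) := by
  classical
  let a : ι → M := fun i ↦ α (Pi.single i 1)
  let J : Finset ι := {j | y j ≠ 0}
  let I : Finset ι := {i | x i ≠ 0}
  have hI : ∀ i ∈ I, Propto (a i) (∑ j ∈ J, a j) := by
    intro i hi
    have hy : Propto y (∑ j ∈ J, Pi.single j 1) := propto_of_forall_ne_zero fun j hj ↦ by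
      simp [Finset.sum_apply, Pi.single_apply, J, hj]
    have := (h.apply_of_ne_zero α (by simpa [I] using hi)).trans_s7 (hy.map α)
    rwa [map_sum] at this
  obtain ⟨κ, _, d, B, hB, hJ⟩ := hM.exists_common_refinement_s7 hC a J I hI
  let b : ι → κ ⊕ ι → ℕ := fun l ↦
    if l ∈ I ∨ l ∈ J then Sum.elim (B l) 0 else Pi.single (Sum.inr l) 1
  let β : (ι → ℕ) →+ (κ ⊕ ι → ℕ) := (Fintype.linearCombination ℕ b).toAddMonoidHom
  have hβ : ∀ v k, β v k = ∑ l, v l * b l k := fun v k ↦ by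
    simp [β, Fintype.linearCombination_apply, Finset.sum_apply]
  let α' : (κ ⊕ ι → ℕ) →+ M := (Fintype.linearCombination ℕ (Sum.elim d a)).toAddMonoidHom
  refine ⟨κ ⊕ ι, inferInstance, β, α', ?_, ?_⟩
  · refine AddMonoidHom.functions_ext _ _ _ fun l m ↦ ?_
    have hb : α' (b l) = a l := by
      simp only [α', LinearMap.toAddMonoidHom_coe, Fintype.linearCombination_apply,
        Fintype.sum_sum_type, Sum.elim_inl, Sum.elim_inr, b]
      split_ifs with hl
      · simp [hB l hl]
      · simp [Pi.single_apply, ite_smul]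
    have hm : (Pi.single l m : ι → ℕ) = m • Pi.single l 1 := by
      rw [← Pi.single_smul, smul_eq_mul, mul_one]
    rw [hm, map_nsmul, map_nsmul, AddMonoidHom.comp_apply,
      show β (Pi.single l 1) = b l by simp [β], hb]
  · refine propto_of_forall_ne_zero fun k hk ↦ ?_
    rw [hβ] at hk ⊢
    obtain ⟨l, -, hl⟩ := exists_ne_zero_of_sum_ne_zero hk
    have hlI : l ∈ I := by simpa [I] using left_ne_zero_of_mul hl
    have hbl := right_ne_zero_of_mul hl
    simp only [b, hlI, true_or, if_true] at hbl
    rcases k with k | k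
    · obtain ⟨j, hj, hjk⟩ := hJ k
      have hyj : y j ≠ 0 := by simpa [J] using hj
      rw [Ne, sum_eq_zero_iff]
      intro h0
      have := h0 j (mem_univ j)
      simp [b, hj, hyj, hjk] at this
    · simp at hbl

lemma exists_factor_forall_propto (hM : IsRefinement M) (hC : IsConical M) {ι : Type} [Fintype ι]
    (α : (ι → ℕ) →+ M) (S : Finset ((ι → ℕ) × (ι → ℕ))) :
    ∃ (κ : Type) (_ : Fintype κ) (β : (ι → ℕ) →+ (κ → ℕ)) (α' : (κ → ℕ) →+ M),
      α'.comp β = α ∧ ∀ p ∈ S, Propto (α p.1) (α p.2) → Propto (β p.1) (β p.2) := by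
  classical
  induction S using Finset.induction_on with
  | empty => exact ⟨ι, inferInstance, AddMonoidHom.id _, α, by simp, by simp⟩
  | insert p S hp ih =>
    obtain ⟨κ, _, β, α', rfl, hβ⟩ := ih
    by_cases hα : Propto (α'.comp β p.1) (α'.comp β p.2)
    · obtain ⟨μ, _, γ, α'', rfl, hγ⟩ := hM.exists_factor_propto hC α' (β p.1) (β p.2) hα
      refine ⟨μ, inferInstance, γ.comp β, α'', rfl, fun q hq h ↦ ?_⟩
      rcases mem_insert.1 hq with rfl | hq
      exacts [hγ, (hβ q hq h).map γ]
    · refine ⟨κ, inferInstance, β, α', rfl, fun q hq h ↦ ?_⟩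
      rcases mem_insert.1 hq with rfl | hq
      exacts [absurd h hα, hβ q hq h]

end IsRefinement

theorem stmt_7 {M : Type*} [AddCommMonoid M] (r : ℕ)
    (hC : IsConical M) (hM : IsRefinement M) (α : (Fin r → ℕ) →+ M) :
    ∃ (s : ℕ) (β : (Fin r → ℕ) →+ (Fin s → ℕ)) (α' : (Fin s → ℕ) →+ M),
      α'.comp β = α ∧
      ∀ x y : Fin r → ℕ, Propto (α x) (α y) → Propto (β x) (β y) := by
  obtain ⟨κ, _, β, α', rfl, hβ⟩ :=
    hM.exists_factor_forall_propto hC α (Finset.Iic 1 ×ˢ Finset.Iic 1)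
  let e : (κ → ℕ) ≃+ (Fin (Fintype.card κ) → ℕ) :=
    (LinearEquiv.funCongrLeft ℕ ℕ (Fintype.equivFin κ).symm).toAddEquiv
  refine ⟨Fintype.card κ, e.toAddMonoidHom.comp β, α'.comp e.symm.toAddMonoidHom, ?_, ?_⟩
  · ext v
    simp
  · intro x y h
    have le_inf (v : Fin r → ℕ) : Propto v (v ⊓ 1) := propto_of_forall_ne_zero (by simp)
    have inf_le (v : Fin r → ℕ) : Propto (v ⊓ 1) v := propto_of_forall_ne_zero (by simp)
    have key := hβ (x ⊓ 1, y ⊓ 1) (by simp)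
      (((inf_le x).map _).trans_s7 (h.trans_s7 ((le_inf y).map _)))
    exact ((((le_inf x).map β).trans_s7 key).trans_s7 ((inf_le y).map β)).map e.toAddMonoidHom
end

section
/- Let M be an additive commutative monoid such that every element x ∈ M can be written as x = 2·y + 3·z for some y, z ∈ M. Let x ∈ M, let r ≥ 1, and let n₁, …, n_r be positive natural numbers such that d = gcd(n₁, …, n_r) divides x in M, i.e., x = d·y for some y ∈ M. Then there exist elements x₁, …, x_r ∈ M with x = n₁·x₁ + ⋯ + n_r·x_r. -/
/-- In a monoid where `2` and `3` generate every element, a submonoid containing all sufficiently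
large multiples `(d * m) • y` of all elements contains all multiples `(d * m) • y` with `m ≠ 0`. -/
theorem AddSubmonoid.mul_nsmul_mem_of_forall_ge {M : Type*} [AddCommMonoid M]
    (hdiv : ∀ x : M, ∃ y z : M, x = 2 • y + 3 • z) (S : AddSubmonoid M) (d N : ℕ)
    (hS : ∀ m, N ≤ m → ∀ y : M, (d * m) • y ∈ S) (m : ℕ) (hm : 1 ≤ m) (y : M) :
    (d * m) • y ∈ S := by
  induction h : N - m using Nat.strong_induction_on generalizing m y with
  | _ k ih =>
    rcases le_or_gt N m with hNm | hNm
    · exact hS m hNm y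
    · obtain ⟨a, b, rfl⟩ := hdiv y
      rw [smul_add, ← mul_smul, ← mul_smul, mul_assoc, mul_assoc]
      exact S.add_mem (ih (N - m * 2) (by omega) _ (by omega) a rfl)
        (ih (N - m * 3) (by omega) _ (by omega) b rfl)

/-- The submonoid of all sums `∑ j, n j • c j`. -/
def AddSubmonoid.sumNSMul (M : Type*) [AddCommMonoid M] {ι : Type*} [Fintype ι] (n : ι → ℕ) :
    AddSubmonoid M where
  carrier := {x | ∃ c : ι → M, x = ∑ j, n j • c j}
  zero_mem' := ⟨0, by simp⟩
  add_mem' := by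
    rintro _ _ ⟨c, rfl⟩ ⟨c', rfl⟩
    exact ⟨c + c', by simp [Finset.sum_add_distrib]⟩

theorem AddSubmonoid.nsmul_mem_sumNSMul {M : Type*} [AddCommMonoid M] {ι : Type*} [Fintype ι]
    (n : ι → ℕ) {m : ℕ} (hm : m ∈ AddSubmonoid.closure (Set.range n)) (y : M) :
    m • y ∈ AddSubmonoid.sumNSMul M n := by
  classical
  induction hm using AddSubmonoid.closure_induction with
  | mem _ h =>
    obtain ⟨j, rfl⟩ := h
    exact ⟨Pi.single j y, by simp [Pi.single_apply]⟩
  | zero => simp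
  | add a b _ _ ha hb =>
    rw [add_smul]
    exact add_mem ha hb

theorem stmt_12 {M : Type*} [AddCommMonoid M]
    (hdiv : ∀ x : M, ∃ y z : M, x = 2 • y + 3 • z)
    (x : M) (r : ℕ) (hr : 1 ≤ r)
    (n : Fin r → ℕ) (hn : ∀ j, 1 ≤ n j)
    (y : M) (hx : x = (Finset.univ.gcd n) • y) :
    ∃ c : Fin r → M, x = ∑ j, n j • c j := by
  obtain ⟨N, hN⟩ := Nat.exists_mem_closure_of_ge (Set.range n)
  have hdvd : Nat.setGcd (Set.range n) ∣ Finset.univ.gcd n := by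
    refine Finset.dvd_gcd fun j _ => Nat.setGcd_dvd_of_mem (Set.mem_range_self j)
  have hpos : 0 < Finset.univ.gcd n := by
    refine Nat.pos_of_ne_zero fun h => ?_
    have := Finset.gcd_eq_zero_iff.1 h ⟨0, hr⟩ (Finset.mem_univ _)
    have := hn ⟨0, hr⟩
    omega
  have hmem := (AddSubmonoid.sumNSMul M n).mul_nsmul_mem_of_forall_ge hdiv (Finset.univ.gcd n) N
    (fun m hm z => AddSubmonoid.nsmul_mem_sumNSMul n
      (hN _ (hm.trans (Nat.le_mul_of_pos_left m hpos)) (hdvd.mul_right m)) z) 1 le_rfl y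
  rw [mul_one, ← hx] at hmem
  exact hmem
end

section
/- Let M be a conical refinement monoid, let n be a natural number, and let x, y ∈ M be such that y ≤ x in the algebraic order, x ∝ y, and M is weakly divisible of degree n at y. Then M is weakly divisible of degree n at x. -/
/-- `M` is weakly divisible of degree `n` at `x` if `x = n₁·x₁ + ⋯ + n_r·x_r`
for some `r ≥ 1`, natural numbers `n₁, …, n_r ≥ n`, and `x₁, …, x_r ∈ M`. -/
def WeaklyDivisibleAt {M : Type*} [AddCommMonoid M] (n : ℕ) (x : M) : Prop :=
  ∃ (r : ℕ), 1 ≤ r ∧ ∃ (ns : Fin r → ℕ) (xs : Fin r → M),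
    (∀ j, n ≤ ns j) ∧ x = ∑ j, ns j • xs j

namespace WeaklyDivisibleAt

variable {M : Type*} [AddCommMonoid M] {n : ℕ}

theorem nsmul {k : ℕ} (hk : n ≤ k) (x : M) : WeaklyDivisibleAt n (k • x) :=
  ⟨1, le_rfl, fun _ => k, fun _ => x, fun _ => hk, by simp⟩

theorem add {x y : M} (hx : WeaklyDivisibleAt n x) (hy : WeaklyDivisibleAt n y) :
    WeaklyDivisibleAt n (x + y) := by
  obtain ⟨r, hr, ns, xs, hns, rfl⟩ := hx
  obtain ⟨s, -, ms, ys, hms, rfl⟩ := hy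
  refine ⟨r + s, by omega, Fin.append ns ms, Fin.append xs ys, fun j => ?_, ?_⟩
  · refine Fin.addCases (fun i => ?_) (fun i => ?_) j
    · simpa using hns i
    · simpa using hms i
  · simp [Fin.sum_univ_add]

end WeaklyDivisibleAt

/-- The Riesz decomposition property of refinement monoids. -/
theorem IsRefinement.exists_add_of_algLE_add {M : Type*} [AddCommMonoid M]
    (hR : IsRefinement M) {z a b : M} (h : AlgLE z (a + b)) :
    ∃ c d : M, z = c + d ∧ AlgLE c a ∧ AlgLE d b := by
  obtain ⟨w, hw⟩ := h
  obtain ⟨c, d, e, f, hz, -, ha, hb⟩ := hR z w a b hw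
  exact ⟨c, d, hz, ⟨e, ha.symm⟩, ⟨f, hb.symm⟩⟩

theorem weaklyDivisibleAt_nsmul_add {M : Type*} [AddCommMonoid M]
    (hC : IsConical M) (hR : IsRefinement M) {n : ℕ} (m : ℕ) :
    ∀ {k : ℕ} {x z : M}, n ≤ k → AlgLE z (m • x) → WeaklyDivisibleAt n (k • x + z) := by
  induction m with
  | zero =>
    rintro k x z hk ⟨w, hw⟩
    obtain ⟨rfl, -⟩ := hC z w (by simpa using hw)
    simpa using WeaklyDivisibleAt.nsmul hk x
  | succ m ih =>
    intro k x z hk hz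
    rw [succ_nsmul'] at hz
    obtain ⟨a, b, rfl, ⟨t, rfl⟩, hb⟩ := hR.exists_add_of_algLE_add hz
    rw [nsmul_add] at hb
    obtain ⟨c, d, rfl, hc, hd⟩ := hR.exists_add_of_algLE_add hb
    have h := (ih (Nat.le_succ_of_le hk) hc).add (ih hk hd)
    convert h using 1
    rw [nsmul_add, succ_nsmul]
    abel

theorem weaklyDivisibleAt_sum_add {M : Type*} [AddCommMonoid M]
    (hC : IsConical M) (hR : IsRefinement M) {n : ℕ} (m r : ℕ) (hr : 1 ≤ r) :
    ∀ (ns : Fin r → ℕ) (xs : Fin r → M) (z : M), (∀ j, n ≤ ns j) →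
      AlgLE z (m • ∑ j, ns j • xs j) → WeaklyDivisibleAt n (∑ j, ns j • xs j + z) := by
  induction r, hr using Nat.le_induction with
  | base =>
    intro ns xs z hns hz
    rw [Fin.sum_univ_one] at hz ⊢
    rw [← mul_nsmul'] at hz
    exact weaklyDivisibleAt_nsmul_add hC hR _ (hns 0) hz
  | succ r hr ih =>
    intro ns xs z hns hz
    rw [Fin.sum_univ_succ] at hz ⊢
    rw [nsmul_add, ← mul_nsmul'] at hz
    obtain ⟨c, d, rfl, hc, hd⟩ := hR.exists_add_of_algLE_add hz
    rw [add_add_add_comm]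
    exact (weaklyDivisibleAt_nsmul_add hC hR _ (hns 0) hc).add
      (ih _ _ d (fun j => hns j.succ) hd)

theorem stmt_13 {M : Type*} [AddCommMonoid M]
    (hC : IsConical M) (hR : IsRefinement M)
    (n : ℕ) (x y : M) (hle : AlgLE y x) (hprop : Propto x y)
    (hdiv : WeaklyDivisibleAt n y) :
    WeaklyDivisibleAt n x := by
  obtain ⟨z, rfl⟩ := hle
  obtain ⟨m, -, w, hw⟩ := hprop
  obtain ⟨r, hr, ns, xs, hns, rfl⟩ := hdiv
  refine weaklyDivisibleAt_sum_add hC hR m r hr ns xs z hns ⟨∑ j, ns j • xs j + w, ?_⟩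
  rw [← hw, add_left_comm, add_assoc]
end

section
/- Let M be an additive commutative monoid with the Riesz decomposition property, let n be a natural number, and let k ≥ 1 be a natural number. Suppose x, u, y, y₁, …, y_r ∈ M and n₁, …, n_r are natural numbers with n_j ≥ n for all j, such that x = y + u, y = n₁·y₁ + ⋯ + n_r·y_r, and u ≤ k·(y₁ + ⋯ + y_r) in the algebraic order. Then there exist a natural number s, natural numbers n'₁, …, n'_s all ≥ n, and elements u', y', y'₁, …, y'_s ∈ M such that x = y' + u', y' = n'₁·y'₁ + ⋯ + n'_s·y'_s, and u' ≤ (k − 1)·(y'₁ + ⋯ + y'_s) in the algebraic order. -/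
/-- The Riesz decomposition property: if `u ≤ a + b` then `u = u₁ + u₂`
with `u₁ ≤ a` and `u₂ ≤ b`. -/
def HasRieszDecomp (M : Type*) [AddCommMonoid M] : Prop :=
  ∀ u a b : M, AlgLE u (a + b) →
    ∃ u₁ u₂ : M, u = u₁ + u₂ ∧ AlgLE u₁ a ∧ AlgLE u₂ b

/-- A Riesz decomposition of an element below a finite sum plus one further term. -/
theorem HasRieszDecomp.exists_sum_add {M : Type*} [AddCommMonoid M] (hM : HasRieszDecomp M)
    {ι : Type*} (s : Finset ι) (a : ι → M) (b u : M) (hu : AlgLE u (∑ i ∈ s, a i + b)) :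
    ∃ (v : ι → M) (w : M), u = ∑ i ∈ s, v i + w ∧ (∀ i ∈ s, AlgLE (v i) (a i)) ∧ AlgLE w b := by
  classical
  induction s using Finset.induction_on generalizing u with
  | empty => exact ⟨a, u, by simp, by simp, by simpa using hu⟩
  | insert j s hj ih =>
    rw [Finset.sum_insert hj, add_assoc] at hu
    obtain ⟨u₁, u₂, rfl, h₁, h₂⟩ := hM _ _ _ hu
    obtain ⟨v, w, rfl, hv, hw⟩ := ih u₂ h₂
    have hne : ∀ i ∈ s, i ≠ j := fun i hi h => hj (h ▸ hi)
    refine ⟨Function.update v j u₁, w, ?_, ?_, hw⟩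
    · rw [Finset.sum_insert hj, Function.update_self, add_assoc,
        Finset.sum_congr rfl fun i hi => Function.update_of_ne (hne i hi) u₁ v]
    · intro i hi
      rcases Finset.mem_insert.1 hi with rfl | hi
      · simpa using h₁
      · simpa [Function.update_of_ne (hne i hi)] using hv i hi

theorem stmt_14 {M : Type*} [AddCommMonoid M] (hM : HasRieszDecomp M)
    (n : ℕ) (k : ℕ) (hk : 1 ≤ k)
    (x u y : M) (r : ℕ) (ys : Fin r → M) (ns : Fin r → ℕ)
    (hns : ∀ j, n ≤ ns j)
    (hx : x = y + u)
    (hy : y = ∑ j, ns j • ys j)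
    (hu : AlgLE u (k • ∑ j, ys j)) :
    ∃ (s : ℕ) (ns' : Fin s → ℕ) (u' y' : M) (ys' : Fin s → M),
      (∀ i, n ≤ ns' i) ∧
      x = y' + u' ∧
      y' = ∑ i, ns' i • ys' i ∧
      AlgLE u' ((k - 1) • ∑ i, ys' i) := by
  obtain ⟨k, rfl⟩ := Nat.exists_eq_add_of_le' hk
  rw [succ_nsmul'] at hu
  obtain ⟨v, w, rfl, hv, hw⟩ := hM.exists_sum_add _ _ _ _ hu
  choose z hz using fun j => hv j (Finset.mem_univ j)
  refine ⟨r + r, Fin.append ns (fun j => ns j + 1), w, _, Fin.append z v, ?_, ?_, rfl, ?_⟩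
  · intro i
    refine Fin.addCases (fun j => ?_) (fun j => ?_) i
    · simpa using hns j
    · rw [Fin.append_right]
      exact (hns j).trans (Nat.le_succ _)
  · rw [hx, hy, ← add_assoc, Fin.sum_univ_add, ← Finset.sum_add_distrib]
    simp only [Fin.append_left, Fin.append_right, ← Finset.sum_add_distrib]
    congr 1
    refine Finset.sum_congr rfl fun j _ => ?_
    rw [← hz j, nsmul_add, succ_nsmul]
    abel
  · have hsum : ∑ i, Fin.append z v i = ∑ j, ys j := by
      simp only [Fin.sum_univ_add, Fin.append_left, Fin.append_right, ← Finset.sum_add_distrib]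
      exact Finset.sum_congr rfl fun j _ => by rw [add_comm, hz j]
    rwa [hsum, Nat.add_sub_cancel]
end
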